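/- arXiv:2204.01362 — 4 statements merged into one kernel-verified Lean document; each statement's English description precedes it below -/
import Mathlib

section
/- Let S be a ring with enough idempotents and {e_i}_{i∈I} a complete set of idempotents for S, and write S_{ij} := e_i S e_j and S_i := S_{ii}. The following three properties are equivalent: (1) for all (i,j,k) ∈ I×I×I, if two of the additive groups S_{ij}, S_{jk}, S_{ik} are nonzero, then the third one is also nonzero and S_{ij} S_{jk} = S_{ik}; (2) for all (p,q) ∈ I×I, if one of the additive groups S_{pq} and S_{qp} is nonzero, then the other one is also nonzero and S_{pq} S_{qp} = S_p; (3) for all (p,q) ∈ I×I, if one of the additive groups S_{pq} and S_{qp} is nonzero, then the other one is also nonzero and e_p ∈ S_{pq} S_{qp}. (Here a product of two additive subgroups denotes the additive group generated by all products of their elements.) -/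
open CategoryTheory

namespace ChainPaper

section NonUnital

variable {S : Type*} [NonUnitalRing S]

/-- The additive subgroup `e S f = {e * s * f | s ∈ S}` of a non-unital ring `S`. -/
def corner (e f : S) : AddSubgroup S :=
  ((AddMonoidHom.mulLeft e).comp (AddMonoidHom.mulRight f)).range

/-- The additive subgroup `S e = {s * e | s ∈ S}`. -/
def rightMulRange (e : S) : AddSubgroup S := (AddMonoidHom.mulRight e).range

/-- The additive subgroup `e S = {e * s | s ∈ S}`. -/
def leftMulRange (e : S) : AddSubgroup S := (AddMonoidHom.mulLeft e).range

/-- The product of two additive subgroups of a ring: the additive subgroup generated by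
all products `a * b` with `a ∈ A`, `b ∈ B`. -/
def sMul (A B : AddSubgroup S) : AddSubgroup S :=
  AddSubgroup.closure {x | ∃ a ∈ A, ∃ b ∈ B, x = a * b}

/-- `I` is a left ideal of the (possibly non-unital) subring whose carrier is
the additive subgroup `C` (closed under multiplication). -/
def IsLeftIdealIn (C I : AddSubgroup S) : Prop :=
  I ≤ C ∧ ∀ s ∈ C, ∀ x ∈ I, s * x ∈ I

def IsRightIdealIn (C I : AddSubgroup S) : Prop :=
  I ≤ C ∧ ∀ s ∈ C, ∀ x ∈ I, x * s ∈ I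

/-- `M` is a left `C`-submodule of `H` (both viewed inside the ambient ring `S`,
with `C` acting by left multiplication). -/
def IsLeftSubmoduleIn (C H M : AddSubgroup S) : Prop :=
  M ≤ H ∧ ∀ s ∈ C, ∀ x ∈ M, s * x ∈ M

def IsRightSubmoduleIn (C H M : AddSubgroup S) : Prop :=
  M ≤ H ∧ ∀ s ∈ C, ∀ x ∈ M, x * s ∈ M

/-- The descending chain condition on the subcollection of additive subgroups of `S`
cut out by the predicate `P`. -/
def DCCOn (P : AddSubgroup S → Prop) : Prop :=
  ∀ f : ℕ → AddSubgroup S, (∀ n, P (f n)) → (∀ n, f (n + 1) ≤ f n) →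
    ∃ n, ∀ m, n ≤ m → f m = f n

/-- The ascending chain condition on the subcollection of additive subgroups of `S`
cut out by the predicate `P`. -/
def ACCOn (P : AddSubgroup S → Prop) : Prop :=
  ∀ f : ℕ → AddSubgroup S, (∀ n, P (f n)) → (∀ n, f n ≤ f (n + 1)) →
    ∃ n, ∀ m, n ≤ m → f m = f n

def LeftArtinianOn (C : AddSubgroup S) : Prop := DCCOn (IsLeftIdealIn C)
def RightArtinianOn (C : AddSubgroup S) : Prop := DCCOn (IsRightIdealIn C)
def LeftNoetherianOn (C : AddSubgroup S) : Prop := ACCOn (IsLeftIdealIn C)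
def RightNoetherianOn (C : AddSubgroup S) : Prop := ACCOn (IsRightIdealIn C)

end NonUnital

/-- A possibly non-unital ring is left artinian if its poset of left ideals
satisfies the descending chain condition. -/
def IsLeftArtinian (S : Type*) [NonUnitalRing S] : Prop := LeftArtinianOn (⊤ : AddSubgroup S)
def IsRightArtinian (S : Type*) [NonUnitalRing S] : Prop := RightArtinianOn (⊤ : AddSubgroup S)
def IsLeftNoetherian (S : Type*) [NonUnitalRing S] : Prop := LeftNoetherianOn (⊤ : AddSubgroup S)
def IsRightNoetherian (S : Type*) [NonUnitalRing S] : Prop := RightNoetherianOn (⊤ : AddSubgroup S)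

section NonUnital2

variable {S : Type*} [NonUnitalRing S]

/-- `{e i}_{i ∈ ι}` is a complete set of idempotents for `S`: the `e i` are nonzero
pairwise orthogonal idempotents and `S = ⊕ᵢ S eᵢ = ⊕ᵢ eᵢ S` as internal direct sums of
additive subgroups. -/
structure IsCompleteIdempotents {ι : Type*} (e : ι → S) : Prop where
  ne_zero : ∀ i, e i ≠ 0
  idem : ∀ i, e i * e i = e i
  orthogonal : ∀ i j, i ≠ j → e i * e j = 0
  indep_right : iSupIndep fun i => rightMulRange (e i)
  span_right : (⨆ i, rightMulRange (e i)) = ⊤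
  indep_left : iSupIndep fun i => leftMulRange (e i)
  span_left : (⨆ i, leftMulRange (e i)) = ⊤

/-- A complete set of idempotents is strong if for all `p q`, whenever one of
`eₚ S e_q` and `e_q S eₚ` is nonzero, then the other is nonzero and `eₚ ∈ (eₚ S e_q)(e_q S eₚ)`. -/
def IsStrongIdempotents {ι : Type*} (e : ι → S) : Prop :=
  ∀ p q : ι,
    (corner (e p) (e q) ≠ ⊥ ∨ corner (e q) (e p) ≠ ⊥) →
      corner (e p) (e q) ≠ ⊥ ∧ corner (e q) (e p) ≠ ⊥ ∧
        e p ∈ sMul (corner (e p) (e q)) (corner (e q) (e p))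

/-- `H` is finitely generated as a left module over `C` (inside the ambient ring `S`,
`C` acting by left multiplication). -/
def IsFGLeftModuleIn (C H : AddSubgroup S) : Prop :=
  ∃ F : Finset S, ↑F ⊆ (H : Set S) ∧
    ∀ x ∈ H, x ∈ sInf {M : AddSubgroup S | ↑F ⊆ (M : Set S) ∧ ∀ s ∈ C, ∀ y ∈ M, s * y ∈ M}

def IsFGRightModuleIn (C H : AddSubgroup S) : Prop :=
  ∃ F : Finset S, ↑F ⊆ (H : Set S) ∧
    ∀ x ∈ H, x ∈ sInf {M : AddSubgroup S | ↑F ⊆ (M : Set S) ∧ ∀ s ∈ C, ∀ y ∈ M, y * s ∈ M}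

end NonUnital2

/-- A small category `G` is hom-set strong if for all objects `x y`, whenever one of
`G(x,y)` and `G(y,x)` is nonempty (here `G(x,y)` denotes the set of morphisms `y → x`),
then the other is nonempty and `𝟙 x ∈ G(x,y)G(y,x)`. -/
def HomSetStrong (G : Type*) [Category G] : Prop :=
  ∀ x y : G, (Nonempty (y ⟶ x) ∨ Nonempty (x ⟶ y)) →
    Nonempty (y ⟶ x) ∧ Nonempty (x ⟶ y) ∧ ∃ (g : y ⟶ x) (h : x ⟶ y), h ≫ g = 𝟙 x

/-- An object unital grading of the (possibly non-unital) ring `S` by the small category `G`: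
`S = ⊕_{g ∈ G₁} S_g` with `S_g S_h ⊆ S_{g ∘ h}` for composable morphisms, `S_g S_h = 0` for
non-composable ones, and each `S_a` (`a ∈ G₀`) is unital and nonzero with identity `one a`
acting as claimed. The component at a morphism `g : a ⟶ b` (in Mathlib's arrow direction) is
`comp g`, and products follow the paper's convention `S_g S_h ⊆ S_{gh}` where `gh` denotes
`h ≫ g`. -/
structure ObjectUnitalGrading (G : Type*) [Category G] (S : Type*) [NonUnitalRing S] where
  comp : ∀ {a b : G}, (a ⟶ b) → AddSubgroup S
  indep : iSupIndep fun p : Σ a : G, Σ b : G, a ⟶ b => comp p.2.2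
  span : (⨆ p : Σ a : G, Σ b : G, a ⟶ b, comp p.2.2) = ⊤
  mul_mem : ∀ {a b c : G} (g : b ⟶ c) (h : a ⟶ b) {x y : S},
    x ∈ comp g → y ∈ comp h → x * y ∈ comp (h ≫ g)
  mul_eq_zero : ∀ {a b a' b' : G} (g : a ⟶ b) (h : a' ⟶ b') {x y : S},
    x ∈ comp g → y ∈ comp h → b' ≠ a → x * y = 0
  one : G → S
  one_mem : ∀ a : G, one a ∈ comp (𝟙 a)
  one_ne_zero : ∀ a : G, one a ≠ 0
  one_mul_mem : ∀ {a b : G} (g : a ⟶ b), ∀ x ∈ comp g, one b * x = x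
  mul_one_mem : ∀ {a b : G} (g : a ⟶ b), ∀ x ∈ comp g, x * one a = x

namespace ObjectUnitalGrading

variable {G : Type*} [Category G] {S : Type*} [NonUnitalRing S]

/-- `E.hom a b = S_{G(b,a)}`, the sum of the components of all morphisms `a ⟶ b`. -/
def hom (E : ObjectUnitalGrading G S) (a b : G) : AddSubgroup S :=
  ⨆ g : a ⟶ b, E.comp g

/-- The grading is strong: `S_g S_h = S_{gh}` for all composable `g, h`. -/
def IsStronglyGraded (E : ObjectUnitalGrading G S) : Prop :=
  ∀ {a b c : G} (g : b ⟶ c) (h : a ⟶ b), sMul (E.comp g) (E.comp h) = E.comp (h ≫ g)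

/-- The grading is hom-set strong: for all objects `p q`, whenever one of `S_{G(p,q)}`
and `S_{G(q,p)}` is nonzero, the other is nonzero and `1_{S_p} ∈ S_{G(p,q)} S_{G(q,p)}`. -/
def IsHomSetStronglyGraded (E : ObjectUnitalGrading G S) : Prop :=
  ∀ p q : G, (E.hom q p ≠ ⊥ ∨ E.hom p q ≠ ⊥) →
    E.hom q p ≠ ⊥ ∧ E.hom p q ≠ ⊥ ∧ E.one p ∈ sMul (E.hom q p) (E.hom p q)

end ObjectUnitalGrading

/-- A group `H` is polycyclic-by-finite if it has a finite length subnormal series with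
each factor a finite group or an infinite cyclic group. -/
def IsPolycyclicByFinite (H : Type*) [Group H] : Prop :=
  ∃ (n : ℕ) (c : Fin (n + 1) → Subgroup H),
    c 0 = ⊥ ∧ c (Fin.last n) = ⊤ ∧
      ∀ i : Fin n,
        c i.castSucc ≤ c i.succ ∧
        ∃ _ : ((c i.castSucc).subgroupOf (c i.succ)).Normal,
          Finite ((c i.succ) ⧸ (c i.castSucc).subgroupOf (c i.succ)) ∨
            (Infinite ((c i.succ) ⧸ (c i.castSucc).subgroupOf (c i.succ)) ∧
              IsCyclic ((c i.succ) ⧸ (c i.castSucc).subgroupOf (c i.succ)))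

/-- Data exhibiting the non-unital ring `A` as the category algebra `T[G]`: an additive
isomorphism with the free `T`-module on the set of morphisms of `G`, matching the
multiplication `(t g)(u h) = (t u)(gh)` for composable `g, h` (where `gh = h ≫ g`) and
`(t g)(u h) = 0` otherwise. -/
structure CategoryAlgebraIso (T : Type*) [Ring T] (G : Type*) [Category G]
    (A : Type*) [NonUnitalRing A] where
  equiv : ((Σ a : G, Σ b : G, a ⟶ b) →₀ T) ≃+ A
  mul_single_comp : ∀ {a b c : G} (g : b ⟶ c) (h : a ⟶ b) (t u : T),
    equiv (Finsupp.single ⟨b, c, g⟩ t) * equiv (Finsupp.single ⟨a, b, h⟩ u) =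
      equiv (Finsupp.single ⟨a, c, h ≫ g⟩ (t * u))
  mul_single_ne : ∀ {a b a' b' : G} (g : a ⟶ b) (h : a' ⟶ b') (t u : T), b' ≠ a →
    equiv (Finsupp.single ⟨a, b, g⟩ t) * equiv (Finsupp.single ⟨a', b', h⟩ u) = 0

/-- Data exhibiting the non-unital ring `A` as the skew category algebra `R *_α G`: an
additive isomorphism with the direct sum `⊕_{g ∈ G₁} R_{c(g)}`, matching the multiplication
`(r g)(r' h) = (r · α_g(r')) (gh)` for composable `g, h` (where `gh = h ≫ g`) and
`(r g)(r' h) = 0` otherwise. -/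
structure SkewCategoryAlgebraIso (G : Type*) [Category G]
    [DecidableEq (Σ a : G, Σ b : G, a ⟶ b)]
    (R : G → Type*) [∀ a, Ring (R a)]
    (α : ∀ ⦃a b : G⦄, (a ⟶ b) → (R a →+* R b))
    (A : Type*) [NonUnitalRing A] where
  equiv : (Π₀ p : Σ a : G, Σ b : G, a ⟶ b, R p.2.1) ≃+ A
  mul_single_comp : ∀ {a b c : G} (g : b ⟶ c) (h : a ⟶ b) (r : R c) (r' : R b),
    equiv (DFinsupp.single ⟨b, c, g⟩ r) * equiv (DFinsupp.single ⟨a, b, h⟩ r') =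
      equiv (DFinsupp.single ⟨a, c, h ≫ g⟩ (r * α g r'))
  mul_single_ne : ∀ {a b a' b' : G} (g : a ⟶ b) (h : a' ⟶ b') (r : R b) (r' : R b'),
    b' ≠ a →
      equiv (DFinsupp.single ⟨a, b, g⟩ r) * equiv (DFinsupp.single ⟨a', b', h⟩ r') = 0


section Corner

variable {S : Type*} [NonUnitalRing S]

lemma mem_corner_iff {e f : S} (he : e * e = e) (hf : f * f = f) {x : S} :
    x ∈ corner e f ↔ e * x = x ∧ x * f = x := by
  constructor
  · rintro ⟨s, rfl⟩
    change e * (e * (s * f)) = e * (s * f) ∧ e * (s * f) * f = e * (s * f)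
    exact ⟨by rw [← mul_assoc, he], by rw [mul_assoc, mul_assoc, hf]⟩
  · rintro ⟨h₁, h₂⟩
    refine ⟨x, ?_⟩
    change e * (x * f) = x
    rw [h₂, h₁]

lemma self_mem_corner {e : S} (he : e * e = e) : e ∈ corner e e :=
  (mem_corner_iff he he).2 ⟨he, he⟩

lemma corner_self_ne_bot {e : S} (he : e * e = e) (h0 : e ≠ 0) : corner e e ≠ ⊥ := fun h =>
  h0 (AddSubgroup.mem_bot.1 (h ▸ self_mem_corner he))

lemma mul_mem_sMul {A B : AddSubgroup S} {a b : S} (ha : a ∈ A) (hb : b ∈ B) :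
    a * b ∈ sMul A B :=
  AddSubgroup.subset_closure ⟨a, ha, b, hb, rfl⟩

lemma sMul_le {A B C : AddSubgroup S} (h : ∀ a ∈ A, ∀ b ∈ B, a * b ∈ C) : sMul A B ≤ C := by
  refine (AddSubgroup.closure_le C).2 ?_
  rintro _ ⟨a, ha, b, hb, rfl⟩
  exact h a ha b hb

lemma mul_mem_corner {e f g : S} (he : e * e = e) (hf : f * f = f) (hg : g * g = g) {a b : S}
    (ha : a ∈ corner e f) (hb : b ∈ corner f g) : a * b ∈ corner e g := by
  rw [mem_corner_iff he hf] at ha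
  rw [mem_corner_iff hf hg] at hb
  rw [mem_corner_iff he hg, ← mul_assoc, ha.1, mul_assoc, hb.2]
  exact ⟨rfl, rfl⟩

lemma corner_le_sMul {e f g : S} (he : e * e = e) (hf : f * f = f) (hg : g * g = g)
    (h : e ∈ sMul (corner e f) (corner f e)) :
    corner e g ≤ sMul (corner e f) (corner f g) := by
  intro x hx
  have hle : sMul (corner e f) (corner f e) ≤
      (sMul (corner e f) (corner f g)).comap (AddMonoidHom.mulRight x) := by
    refine sMul_le fun a ha b hb => ?_
    change a * b * x ∈ sMul (corner e f) (corner f g)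
    rw [mul_assoc]
    exact mul_mem_sMul ha (mul_mem_corner hf he hg hb hx)
  have hex : e * x ∈ sMul (corner e f) (corner f g) := hle h
  rwa [((mem_corner_iff he hg).1 hx).1] at hex

lemma sMul_corner_eq {e f g : S} (he : e * e = e) (hf : f * f = f) (hg : g * g = g)
    (h : e ∈ sMul (corner e f) (corner f e)) :
    sMul (corner e f) (corner f g) = corner e g :=
  le_antisymm (sMul_le fun _ ha _ hb => mul_mem_corner he hf hg ha hb)
    (corner_le_sMul he hf hg h)

lemma corner_ne_bot_of_mem_sMul {e f g : S} (he : e * e = e) (hf : f * f = f) (hg : g * g = g)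
    (h : e ∈ sMul (corner e f) (corner f e)) (hne : corner e g ≠ ⊥) : corner f g ≠ ⊥ := by
  intro hbot
  refine hne (le_bot_iff.1 ((corner_le_sMul he hf hg h).trans (sMul_le fun a _ b hb => ?_)))
  rw [hbot, AddSubgroup.mem_bot] at hb
  rw [hb, mul_zero]
  exact zero_mem _

end Corner

lemma IsStrongIdempotents.corner_trans {S : Type*} [NonUnitalRing S] {ι : Type*} {e : ι → S}
    (hs : IsStrongIdempotents e) (he : ∀ i, e i * e i = e i) {i j k : ι}
    (hij : corner (e i) (e j) ≠ ⊥) (hjk : corner (e j) (e k) ≠ ⊥) :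
    corner (e i) (e k) ≠ ⊥ :=
  corner_ne_bot_of_mem_sMul (he j) (he i) (he k) (hs j i (Or.inr hij)).2.2 hjk

theorem statement_2 {S : Type*} [NonUnitalRing S] {ι : Type*} (e : ι → S)
    (he : IsCompleteIdempotents e) :
    ((∀ i j k : ι,
        ((corner (e i) (e j) ≠ ⊥ ∧ corner (e j) (e k) ≠ ⊥) ∨
          (corner (e i) (e j) ≠ ⊥ ∧ corner (e i) (e k) ≠ ⊥) ∨
          (corner (e j) (e k) ≠ ⊥ ∧ corner (e i) (e k) ≠ ⊥)) →
        corner (e i) (e j) ≠ ⊥ ∧ corner (e j) (e k) ≠ ⊥ ∧ corner (e i) (e k) ≠ ⊥ ∧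
          sMul (corner (e i) (e j)) (corner (e j) (e k)) = corner (e i) (e k)) ↔
      (∀ p q : ι, (corner (e p) (e q) ≠ ⊥ ∨ corner (e q) (e p) ≠ ⊥) →
        corner (e p) (e q) ≠ ⊥ ∧ corner (e q) (e p) ≠ ⊥ ∧
          sMul (corner (e p) (e q)) (corner (e q) (e p)) = corner (e p) (e p))) ∧
    ((∀ p q : ι, (corner (e p) (e q) ≠ ⊥ ∨ corner (e q) (e p) ≠ ⊥) →
        corner (e p) (e q) ≠ ⊥ ∧ corner (e q) (e p) ≠ ⊥ ∧
          sMul (corner (e p) (e q)) (corner (e q) (e p)) = corner (e p) (e p)) ↔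
      IsStrongIdempotents e) := by
  have hid := he.idem
  have hstrong : (∀ p q : ι, (corner (e p) (e q) ≠ ⊥ ∨ corner (e q) (e p) ≠ ⊥) →
        corner (e p) (e q) ≠ ⊥ ∧ corner (e q) (e p) ≠ ⊥ ∧
          sMul (corner (e p) (e q)) (corner (e q) (e p)) = corner (e p) (e p)) ↔
      IsStrongIdempotents e := by
    constructor
    · intro h p q hpq
      obtain ⟨h₁, h₂, h₃⟩ := h p q hpq
      exact ⟨h₁, h₂, h₃ ▸ self_mem_corner (hid p)⟩
    · intro h p q hpq
      obtain ⟨h₁, h₂, h₃⟩ := h p q hpq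
      exact ⟨h₁, h₂, sMul_corner_eq (hid p) (hid q) (hid p) h₃⟩
  refine ⟨⟨fun h p q hpq => ?_, fun h i j k hijk => ?_⟩, hstrong⟩
  · have hp := corner_self_ne_bot (hid p) (he.ne_zero p)
    obtain ⟨h₁, h₂, -, h₃⟩ := h p q p
      (hpq.elim (fun hne => Or.inr (Or.inl ⟨hne, hp⟩)) fun hne => Or.inr (Or.inr ⟨hne, hp⟩))
    exact ⟨h₁, h₂, h₃⟩
  · have hs := hstrong.1 h
    have hall : corner (e i) (e j) ≠ ⊥ ∧ corner (e j) (e k) ≠ ⊥ ∧ corner (e i) (e k) ≠ ⊥ := by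
      rcases hijk with ⟨hij, hjk⟩ | ⟨hij, hik⟩ | ⟨hjk, hik⟩
      · exact ⟨hij, hjk, hs.corner_trans hid hij hjk⟩
      · exact ⟨hij, hs.corner_trans hid (hs i j (Or.inl hij)).2.1 hik, hik⟩
      · exact ⟨hs.corner_trans hid hik (hs j k (Or.inl hjk)).2.1, hjk, hik⟩
    exact ⟨hall.1, hall.2.1, hall.2.2,
      sMul_corner_eq (hid i) (hid j) (hid k) (hs i j (Or.inl hall.1)).2.2⟩

end ChainPaper
end

section
/- Let S be a ring with enough idempotents and let {e_i}_{i∈I} be a strong complete set of idempotents for S. Then, for each of the four chain conditions (left artinian, right artinian, left noetherian, right noetherian), S satisfies the chain condition if and only if I is finite and for every i ∈ I the corner ring e_i S e_i satisfies the same chain condition. -/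
open CategoryTheory

namespace ChainPaper

section ChainConditions

/-- The condition that every sequence of additive subgroups satisfying `P` whose consecutive
terms are related by `R` is eventually constant. -/
def ChainOn {S : Type*} [AddGroup S] (R : AddSubgroup S → AddSubgroup S → Prop)
    (P : AddSubgroup S → Prop) : Prop :=
  ∀ f : ℕ → AddSubgroup S, (∀ n, P (f n)) → (∀ n, R (f n) (f (n + 1))) →
    ∃ n, ∀ m, n ≤ m → f m = f n

/-- The relation `R` is one of the two orders `≤` and `≥`. -/
def IsOrderOrDual {S : Type*} [AddGroup S] (R : AddSubgroup S → AddSubgroup S → Prop) : Prop :=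
  (R = fun A B => A ≤ B) ∨ (R = fun A B => B ≤ A)

section AddGroup

variable {S : Type*} [AddGroup S] {R : AddSubgroup S → AddSubgroup S → Prop}

theorem IsOrderOrDual.map (hR : IsOrderOrDual R) {g : AddSubgroup S → AddSubgroup S}
    (hg : Monotone g) {A B : AddSubgroup S} (h : R A B) : R (g A) (g B) := by
  rcases hR with rfl | rfl <;> exact hg h

theorem IsOrderOrDual.le_or_le (hR : IsOrderOrDual R) {f : ℕ → AddSubgroup S}
    (h : ∀ n, R (f n) (f (n + 1))) {n m : ℕ} (hnm : n ≤ m) : f n ≤ f m ∨ f m ≤ f n := by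
  rcases hR with rfl | rfl
  · exact Or.inl (monotone_nat_of_le_succ h hnm)
  · exact Or.inr (antitone_nat_of_succ_le h hnm)

end AddGroup

theorem eq_of_le_of_map_eq_of_inf_ker_eq {S : Type*} [AddGroup S] (φ : S →+ S)
    {A B : AddSubgroup S} (h : A ≤ B) (hmap : A.map φ = B.map φ)
    (hker : A ⊓ φ.ker = B ⊓ φ.ker) : A = B := by
  refine le_antisymm h fun x hx => ?_
  obtain ⟨y, hy, hxy⟩ : φ x ∈ A.map φ := hmap ▸ AddSubgroup.mem_map_of_mem φ hx
  have hk : x - y ∈ B ⊓ φ.ker :=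
    ⟨B.sub_mem hx (h hy), AddMonoidHom.mem_ker.2 (by rw [map_sub, hxy, sub_self])⟩
  rw [← hker] at hk
  simpa using A.add_mem hk.1 hy

section Ring

variable {S : Type*} [NonUnitalRing S] {R : AddSubgroup S → AddSubgroup S → Prop}

theorem mem_corner {e f x : S} : x ∈ corner e f ↔ ∃ s, e * (s * f) = x := Iff.rfl

theorem mul_eq_self_of_mem_corner {e f x : S} (he : e * e = e) (hx : x ∈ corner e f) :
    e * x = x := by
  obtain ⟨s, rfl⟩ := mem_corner.1 hx
  rw [← mul_assoc, he]

theorem eq_mul_self_of_mem_corner {e f x : S} (hf : f * f = f) (hx : x ∈ corner e f) :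
    x * f = x := by
  obtain ⟨s, rfl⟩ := mem_corner.1 hx
  rw [mul_assoc, mul_assoc, hf]

theorem exists_finite_forall_mul_eq_zero_of_mem_sMul {A B : AddSubgroup S} {y : S}
    (hy : y ∈ sMul A B) :
    ∃ F : Set S, F.Finite ∧ F ⊆ A ∧ ∀ x, (∀ a ∈ F, x * a = 0) → x * y = 0 := by
  induction hy using AddSubgroup.closure_induction with
  | mem y hy =>
    obtain ⟨a, ha, b, -, rfl⟩ := hy
    refine ⟨{a}, Set.finite_singleton a, by simpa using ha, fun x hx => ?_⟩
    rw [← mul_assoc, hx a rfl, zero_mul]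
  | zero => exact ⟨∅, Set.finite_empty, Set.empty_subset _, fun x _ => mul_zero x⟩
  | add y z _ _ hy hz =>
    obtain ⟨F, hF, hFA, h⟩ := hy
    obtain ⟨G, hG, hGA, h'⟩ := hz
    refine ⟨F ∪ G, hF.union hG, Set.union_subset hFA hGA, fun x hx => ?_⟩
    rw [mul_add, h x fun a ha => hx a (Or.inl ha), h' x fun a ha => hx a (Or.inr ha), add_zero]
  | neg y _ hy =>
    obtain ⟨F, hF, hFA, h⟩ := hy
    exact ⟨F, hF, hFA, fun x hx => by rw [mul_neg, h x hx, neg_zero]⟩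

/-- The largest left ideal of `S` whose left multiple by `e` lies in `L`. -/
def leftIdealColon (e : S) (L : AddSubgroup S) : AddSubgroup S where
  carrier := {x | ∀ s, e * s * x ∈ L}
  zero_mem' s := by simp [L.zero_mem]
  add_mem' hx hy s := by rw [mul_add]; exact L.add_mem (hx s) (hy s)
  neg_mem' hx s := by rw [mul_neg]; exact L.neg_mem (hx s)

theorem leftIdealColon_mono (e : S) : Monotone (leftIdealColon e) :=
  fun _ _ h _ hx s => h (hx s)

theorem isLeftIdealIn_top_leftIdealColon (e : S) (L : AddSubgroup S) :
    IsLeftIdealIn ⊤ (leftIdealColon e L) :=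
  ⟨le_top, fun t _ x hx s => by simpa only [mul_assoc] using hx (s * t)⟩

theorem leftIdealColon_inf_corner {e : S} (he : e * e = e) {L : AddSubgroup S}
    (hL : IsLeftIdealIn (corner e e) L) : leftIdealColon e L ⊓ corner e e = L := by
  ext x
  constructor
  · rintro ⟨hx, hxc⟩
    have := hx e
    rwa [he, mul_eq_self_of_mem_corner he hxc] at this
  · refine fun hx => ⟨fun s => ?_, hL.1 hx⟩
    rw [← mul_eq_self_of_mem_corner he (hL.1 hx), ← mul_assoc, mul_assoc e]
    exact hL.2 _ ⟨s, rfl⟩ x hx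

theorem ChainOn.corner_of_top (hR : IsOrderOrDual R) (h : ChainOn R (IsLeftIdealIn ⊤))
    {e : S} (he : e * e = e) : ChainOn R (IsLeftIdealIn (corner e e)) := by
  intro f hf hfR
  obtain ⟨n, hn⟩ := h (fun n => leftIdealColon e (f n))
    (fun n => isLeftIdealIn_top_leftIdealColon e _)
    fun n => hR.map (leftIdealColon_mono e) (hfR n)
  refine ⟨n, fun m hm => ?_⟩
  rw [← leftIdealColon_inf_corner he (hf m), ← leftIdealColon_inf_corner he (hf n)]
  exact congrArg (· ⊓ corner e e) (hn m hm)

/-- The left annihilator of a set. -/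
def leftAnnihilator (A : Set S) : AddSubgroup S where
  carrier := {x | ∀ a ∈ A, x * a = 0}
  zero_mem' a _ := zero_mul a
  add_mem' hx hy a ha := by rw [add_mul, hx a ha, hy a ha, add_zero]
  neg_mem' hx a ha := by rw [neg_mul, hx a ha, neg_zero]

theorem isLeftIdealIn_top_leftAnnihilator (A : Set S) :
    IsLeftIdealIn ⊤ (leftAnnihilator A) :=
  ⟨le_top, fun s _ x hx a ha => by rw [mul_assoc, hx a ha, mul_zero]⟩

theorem leftAnnihilator_anti : Antitone (leftAnnihilator : Set S → AddSubgroup S) :=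
  fun _ _ h _ hx a ha => hx a (h ha)

theorem IsOrderOrDual.finite_of_chainOn (hR : IsOrderOrDual R)
    (h : ChainOn R (IsLeftIdealIn ⊤)) {ι : Type*} {e : ι → S}
    (ne_zero : ∀ i, e i ≠ 0) (idem : ∀ i, e i * e i = e i)
    (orthogonal : ∀ i j, i ≠ j → e i * e j = 0) : Finite ι := by
  by_contra hι
  rw [not_finite_iff_infinite] at hι
  let u := Infinite.natEmbedding ι
  have key : ∀ A : Set ℕ, ∀ k,
      e (u k) ∈ leftAnnihilator ((fun l => e (u l)) '' A) ↔ k ∉ A := by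
    refine fun A k => ⟨fun hk hkA => ?_, ?_⟩
    · have := hk _ ⟨k, hkA, rfl⟩
      rw [idem] at this
      exact ne_zero _ this
    · rintro hk _ ⟨l, hl, rfl⟩
      refine orthogonal _ _ fun hkl => hk ?_
      rwa [u.injective hkl]
  rcases hR with rfl | rfl
  · obtain ⟨n, hn⟩ := h (fun n => leftAnnihilator ((fun l => e (u l)) '' Set.Ici n))
      (fun n => isLeftIdealIn_top_leftAnnihilator _)
      fun n => leftAnnihilator_anti (Set.image_mono (Set.Ici_subset_Ici.2 n.le_succ))
    have h1 := (key (Set.Ici (n + 1)) n).2 (by simp)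
    exact (key (Set.Ici n) n).1 (hn (n + 1) n.le_succ ▸ h1) (by simp)
  · obtain ⟨n, hn⟩ := h (fun n => leftAnnihilator ((fun l => e (u l)) '' Set.Iio n))
      (fun n => isLeftIdealIn_top_leftAnnihilator _)
      fun n => leftAnnihilator_anti (Set.image_mono (Set.Iio_subset_Iio n.le_succ))
    have h1 := (key (Set.Iio n) n).2 (by simp)
    exact (key (Set.Iio (n + 1)) n).1 ((hn (n + 1) n.le_succ).symm ▸ h1) (by simp)

/-- The additive map `x ↦ e * (x * a)`. -/
def mulLeftRight (e a : S) : S →+ S := (AddMonoidHom.mulLeft e).comp (AddMonoidHom.mulRight a)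

/-- Chains of subgroups stable under the corner rings stabilise as soon as finitely many maps
`x ↦ eᵢ x a` with `a ∈ S eᵢ` jointly detect zero on them. -/
theorem IsOrderOrDual.stabilises_of_finite_separating (hR : IsOrderOrDual R) {ι : Type*}
    {e : ι → S} (idem : ∀ i, e i * e i = e i) (orthogonal : ∀ i j, i ≠ j → e i * e j = 0)
    (hc : ∀ i, ChainOn R (IsLeftIdealIn (corner (e i) (e i)))) {T : Set (ι × S)}
    (hT : T.Finite) (hTe : ∀ t ∈ T, t.2 * e t.1 = t.2) (f : ℕ → AddSubgroup S)
    (hf : ∀ n i, ∀ s ∈ corner (e i) (e i), ∀ x ∈ f n, s * x ∈ f n)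
    (hfR : ∀ n, R (f n) (f (n + 1)))
    (hsep : ∀ n, ∀ x ∈ f n, (∀ t ∈ T, e t.1 * (x * t.2) = 0) → x = 0) :
    ∃ n, ∀ m, n ≤ m → f m = f n := by
  induction T, hT using Set.Finite.induction_on generalizing f with
  | empty =>
    have hbot : ∀ n, f n = ⊥ := fun n =>
      (AddSubgroup.eq_bot_iff_forall _).2 fun x hx => hsep n x hx (by simp)
    exact ⟨0, fun m _ => by rw [hbot, hbot]⟩
  | @insert t T _ _ ih =>
    obtain ⟨i, a⟩ := t
    have ha : a * e i = a := hTe _ (Set.mem_insert _ _)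
    let φ := mulLeftRight (e i) a
    obtain ⟨n₁, hn₁⟩ := ih (fun t ht => hTe t (Set.mem_insert_of_mem _ ht))
      (fun n => f n ⊓ φ.ker)
      (by
        rintro n j s hs x ⟨hx, hxk⟩
        refine ⟨hf n j s hs x hx, ?_⟩
        replace hxk : e i * (x * a) = 0 := hxk
        change e i * (s * x * a) = 0
        by_cases hij : i = j
        · subst hij
          rw [mul_assoc, ← mul_assoc, mul_eq_self_of_mem_corner (idem i) hs,
            ← eq_mul_self_of_mem_corner (idem i) hs, mul_assoc, hxk, mul_zero]
        · rw [← mul_eq_self_of_mem_corner (idem j) hs, mul_assoc, mul_assoc, ← mul_assoc (e i),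
            orthogonal i j hij, zero_mul])
      (fun n => hR.map (g := (· ⊓ φ.ker)) (fun _ _ h => inf_le_inf_right _ h) (hfR n))
      (fun n x hx hxT => hsep n x hx.1 fun t ht => by
        rcases Set.mem_insert_iff.1 ht with rfl | ht
        · exact hx.2
        · exact hxT t ht)
    obtain ⟨n₂, hn₂⟩ := hc i (fun n => (f n).map φ)
      (by
        refine fun n => ⟨?_, ?_⟩
        · rintro _ ⟨x, -, rfl⟩
          exact ⟨x * a, by change e i * (x * a * e i) = e i * (x * a); rw [mul_assoc, ha]⟩
        · rintro s hs _ ⟨x, hx, rfl⟩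
          refine ⟨s * x, hf n i s hs x hx, ?_⟩
          change e i * (s * x * a) = s * (e i * (x * a))
          rw [← mul_assoc s, eq_mul_self_of_mem_corner (idem i) hs, mul_assoc, ← mul_assoc,
            mul_eq_self_of_mem_corner (idem i) hs])
      (fun n => hR.map (g := AddSubgroup.map φ) (fun _ _ h => AddSubgroup.map_mono h) (hfR n))
    refine ⟨max n₁ n₂, fun m hm => ?_⟩
    have h₁ : f m ⊓ φ.ker = f (max n₁ n₂) ⊓ φ.ker :=
      (hn₁ m (le_of_max_le_left hm)).trans (hn₁ _ (le_max_left _ _)).symm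
    have h₂ : (f m).map φ = (f (max n₁ n₂)).map φ :=
      (hn₂ m (le_of_max_le_right hm)).trans (hn₂ _ (le_max_right _ _)).symm
    rcases hR.le_or_le hfR hm with h | h
    · exact (eq_of_le_of_map_eq_of_inf_ker_eq φ h h₂.symm h₁.symm).symm
    · exact eq_of_le_of_map_eq_of_inf_ker_eq φ h h₂ h₁

namespace IsCompleteIdempotents

variable {ι : Type*} {e : ι → S}

theorem sum_mul [Fintype ι] (he : IsCompleteIdempotents e) (x : S) : ∑ i, e i * x = x := by
  classical
  have hx : x ∈ ⨆ i, leftMulRange (e i) := he.span_left ▸ AddSubgroup.mem_top x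
  induction hx using AddSubgroup.iSup_induction' with
  | hp i x hx =>
    obtain ⟨s, rfl⟩ := hx
    change ∑ j, e j * (e i * s) = e i * s
    rw [Finset.sum_eq_single i (fun j _ hj => by
      rw [← mul_assoc, he.orthogonal j i hj, zero_mul]) (by simp), ← mul_assoc, he.idem]
  | h1 => simp
  | hadd x y _ _ hx hy => simp only [mul_add, Finset.sum_add_distrib, hx, hy]

theorem mul_sum [Fintype ι] (he : IsCompleteIdempotents e) (x : S) : ∑ i, x * e i = x := by
  classical
  have hx : x ∈ ⨆ i, rightMulRange (e i) := he.span_right ▸ AddSubgroup.mem_top x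
  induction hx using AddSubgroup.iSup_induction' with
  | hp i x hx =>
    obtain ⟨s, rfl⟩ := hx
    change ∑ j, s * e i * e j = s * e i
    rw [Finset.sum_eq_single i (fun j _ hj => by
      rw [mul_assoc, he.orthogonal i j hj.symm, mul_zero]) (by simp), mul_assoc, he.idem]
  | h1 => simp
  | hadd x y _ _ hx hy => simp only [add_mul, Finset.sum_add_distrib, hx, hy]

end IsCompleteIdempotents

theorem IsStrongIdempotents.exists_finite_separating {ι : Type*} {e : ι → S}
    (hs : IsStrongIdempotents e) (i j : ι) :
    ∃ F : Set S, F.Finite ∧ F ⊆ corner (e j) (e i) ∧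
      ∀ x, (∀ a ∈ F, e i * x * a = 0) → e i * x * e j = 0 := by
  by_cases h : corner (e j) (e i) ≠ ⊥ ∨ corner (e i) (e j) ≠ ⊥
  · obtain ⟨F, hF, hFA, hx⟩ := exists_finite_forall_mul_eq_zero_of_mem_sMul (hs j i h).2.2
    exact ⟨F, hF, hFA, fun x => hx _⟩
  · push Not at h
    refine ⟨∅, Set.finite_empty, Set.empty_subset _, fun x _ => ?_⟩
    have hx : e i * (x * e j) ∈ corner (e i) (e j) := ⟨x, rfl⟩
    rwa [h.2, AddSubgroup.mem_bot, ← mul_assoc] at hx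

theorem IsStrongIdempotents.chainOn_left_iff (hR : IsOrderOrDual R) {ι : Type*} {e : ι → S}
    (he : IsCompleteIdempotents e) (hs : IsStrongIdempotents e) :
    ChainOn R (IsLeftIdealIn ⊤) ↔
      (Finite ι ∧ ∀ i, ChainOn R (IsLeftIdealIn (corner (e i) (e i)))) := by
  refine ⟨fun h => ⟨hR.finite_of_chainOn h he.ne_zero he.idem he.orthogonal,
    fun i => h.corner_of_top hR (he.idem i)⟩, ?_⟩
  rintro ⟨hι, hc⟩ f hf hfR
  cases nonempty_fintype ι
  choose F hF hFc hFs using hs.exists_finite_separating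
  refine hR.stabilises_of_finite_separating he.idem he.orthogonal hc
    (T := ⋃ i, ⋃ j, Prod.mk i '' F i j)
    (Set.finite_iUnion fun i => Set.finite_iUnion fun j => (hF i j).image _)
    ?_ f (fun n i s _ => (hf n).2 s (AddSubgroup.mem_top s)) hfR ?_
  · intro t ht
    simp only [Set.mem_iUnion] at ht
    obtain ⟨i, j, a, ha, rfl⟩ := ht
    exact eq_mul_self_of_mem_corner (he.idem i) (hFc i j ha)
  · intro n x _ hx
    rw [← he.sum_mul x]
    refine Finset.sum_eq_zero fun i _ => ?_
    rw [← he.mul_sum (e i * x)]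
    refine Finset.sum_eq_zero fun j _ => hFs i j x fun a ha => ?_
    rw [mul_assoc]
    exact hx (i, a) (Set.mem_iUnion.2 ⟨i, Set.mem_iUnion.2 ⟨j, a, ha, rfl⟩⟩)

end Ring

/-- The opposite ring structure, on the same additive group. -/
abbrev oppositeRing (S : Type*) [inst : NonUnitalRing S] : NonUnitalRing S :=
  { inst with
    mul := fun a b => b * a
    left_distrib := fun a b c => add_mul b c a
    right_distrib := fun a b c => mul_add c a b
    zero_mul := fun a => mul_zero a
    mul_zero := fun a => zero_mul a
    mul_assoc := fun a b c => (mul_assoc c b a).symm }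

section Opposite

variable {S : Type*} [inst : NonUnitalRing S]

theorem corner_oppositeRing (e f : S) : @corner S (oppositeRing S) e f = corner f e :=
  AddSubgroup.ext fun x => exists_congr fun s => by
    change f * s * e = x ↔ f * (s * e) = x
    rw [mul_assoc]

theorem sMul_oppositeRing (A B : AddSubgroup S) : @sMul S (oppositeRing S) A B = sMul B A := by
  refine congrArg AddSubgroup.closure (Set.ext fun x => ?_)
  exact ⟨fun ⟨a, ha, b, hb, h⟩ => ⟨b, hb, a, ha, h⟩, fun ⟨a, ha, b, hb, h⟩ => ⟨b, hb, a, ha, h⟩⟩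

theorem IsCompleteIdempotents.oppositeRing {ι : Type*} {e : ι → S}
    (he : IsCompleteIdempotents e) : @IsCompleteIdempotents S (oppositeRing S) ι e :=
  @IsCompleteIdempotents.mk S (ChainPaper.oppositeRing S) ι e he.ne_zero he.idem
    (fun i j h => he.orthogonal j i h.symm) he.indep_left he.span_left he.indep_right
    he.span_right

theorem IsStrongIdempotents.oppositeRing {ι : Type*} {e : ι → S}
    (hs : IsStrongIdempotents e) : @IsStrongIdempotents S (oppositeRing S) ι e := by
  intro p q h
  rw [corner_oppositeRing, corner_oppositeRing] at h ⊢
  rw [sMul_oppositeRing]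
  obtain ⟨h₁, h₂, h₃⟩ := hs p q h.symm
  exact ⟨h₂, h₁, h₃⟩

theorem IsStrongIdempotents.chainOn_right_iff {R : AddSubgroup S → AddSubgroup S → Prop}
    (hR : IsOrderOrDual R) {ι : Type*} {e : ι → S}
    (he : IsCompleteIdempotents e) (hs : IsStrongIdempotents e) :
    ChainOn R (IsRightIdealIn ⊤) ↔
      (Finite ι ∧ ∀ i, ChainOn R (IsRightIdealIn (corner (e i) (e i)))) := by
  have h := @IsStrongIdempotents.chainOn_left_iff S (ChainPaper.oppositeRing S) R hR ι e
    he.oppositeRing hs.oppositeRing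
  simp only [corner_oppositeRing] at h
  exact h

end Opposite

end ChainConditions

theorem statement_6 {S : Type*} [NonUnitalRing S] {ι : Type*} (e : ι → S)
    (he : IsCompleteIdempotents e) (hs : IsStrongIdempotents e) :
    (IsLeftArtinian S ↔ (Finite ι ∧ ∀ i, LeftArtinianOn (corner (e i) (e i)))) ∧
    (IsRightArtinian S ↔ (Finite ι ∧ ∀ i, RightArtinianOn (corner (e i) (e i)))) ∧
    (IsLeftNoetherian S ↔ (Finite ι ∧ ∀ i, LeftNoetherianOn (corner (e i) (e i)))) ∧
    (IsRightNoetherian S ↔ (Finite ι ∧ ∀ i, RightNoetherianOn (corner (e i) (e i)))) :=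
  ⟨hs.chainOn_left_iff (Or.inr rfl) he, hs.chainOn_right_iff (Or.inr rfl) he,
    hs.chainOn_left_iff (Or.inl rfl) he, hs.chainOn_right_iff (Or.inl rfl) he⟩


end ChainPaper
end

section
/- For a small category G, the following three properties are equivalent: (1) for all objects (a,b,c), if two of the sets G(a,b), G(b,c), G(a,c) are nonempty, then the third is nonempty and G(a,b)G(b,c) = G(a,c); (2) for all objects (x,y), if one of the sets G(x,y) and G(y,x) is nonempty, then the other is nonempty and G(x,y)G(y,x) = G(x); (3) for all objects (x,y), if one of the sets G(x,y) and G(y,x) is nonempty, then the other is nonempty and the identity morphism of x lies in G(x,y)G(y,x). -/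
open CategoryTheory

namespace ChainPaper

/-- In a hom-set strong category, every morphism into `a` factors through any object `b`
connected to `a`. -/
theorem HomSetStrong.exists_comp_eq {G : Type*} [Category G] (hG : HomSetStrong G) {a b c : G}
    (hab : Nonempty (b ⟶ a)) (k : c ⟶ a) : ∃ (g : b ⟶ a) (h : c ⟶ b), h ≫ g = k := by
  obtain ⟨-, -, g, h, hgh⟩ := hG a b (.inl hab)
  exact ⟨g, k ≫ h, by rw [Category.assoc, hgh, Category.comp_id]⟩

theorem HomSetStrong.nonempty_symm {G : Type*} [Category G] (hG : HomSetStrong G) {a b : G}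
    (hab : Nonempty (b ⟶ a)) : Nonempty (a ⟶ b) :=
  (hG a b (.inl hab)).2.1

theorem statement_7 (G : Type*) [Category G] :
    ((∀ a b c : G,
        ((Nonempty (b ⟶ a) ∧ Nonempty (c ⟶ b)) ∨ (Nonempty (b ⟶ a) ∧ Nonempty (c ⟶ a)) ∨
          (Nonempty (c ⟶ b) ∧ Nonempty (c ⟶ a))) →
        Nonempty (b ⟶ a) ∧ Nonempty (c ⟶ b) ∧ Nonempty (c ⟶ a) ∧
          ∀ k : c ⟶ a, ∃ (g : b ⟶ a) (h : c ⟶ b), h ≫ g = k) ↔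
      (∀ x y : G, (Nonempty (y ⟶ x) ∨ Nonempty (x ⟶ y)) →
        Nonempty (y ⟶ x) ∧ Nonempty (x ⟶ y) ∧
          ∀ k : x ⟶ x, ∃ (g : y ⟶ x) (h : x ⟶ y), h ≫ g = k)) ∧
    ((∀ x y : G, (Nonempty (y ⟶ x) ∨ Nonempty (x ⟶ y)) →
        Nonempty (y ⟶ x) ∧ Nonempty (x ⟶ y) ∧
          ∀ k : x ⟶ x, ∃ (g : y ⟶ x) (h : x ⟶ y), h ≫ g = k) ↔ HomSetStrong G) := by
  have strong_of_surj (H : ∀ x y : G, (Nonempty (y ⟶ x) ∨ Nonempty (x ⟶ y)) →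
      Nonempty (y ⟶ x) ∧ Nonempty (x ⟶ y) ∧
        ∀ k : x ⟶ x, ∃ (g : y ⟶ x) (h : x ⟶ y), h ≫ g = k) : HomSetStrong G :=
    fun x y hxy => ⟨(H x y hxy).1, (H x y hxy).2.1, (H x y hxy).2.2 (𝟙 x)⟩
  refine ⟨⟨fun H x y hxy => ?_, fun H a b c habc => ?_⟩, strong_of_surj, fun hG x y hxy => ?_⟩
  · have hxx : Nonempty (x ⟶ x) := ⟨𝟙 x⟩
    obtain ⟨h₁, h₂, -, h₃⟩ := H x y x <| hxy.elim (fun h => .inr (.inl ⟨h, hxx⟩))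
      fun h => .inr (.inr ⟨h, hxx⟩)
    exact ⟨h₁, h₂, h₃⟩
  · have hG := strong_of_surj H
    have trans {p q r : G} : Nonempty (p ⟶ q) → Nonempty (q ⟶ r) → Nonempty (p ⟶ r) :=
      fun ⟨f⟩ ⟨g⟩ => ⟨f ≫ g⟩
    rcases habc with ⟨hba, hcb⟩ | ⟨hba, hca⟩ | ⟨hcb, hca⟩
    · exact ⟨hba, hcb, trans hcb hba, hG.exists_comp_eq hba⟩
    · exact ⟨hba, trans hca (hG.nonempty_symm hba), hca, hG.exists_comp_eq hba⟩
    · have hba := trans (hG.nonempty_symm hcb) hca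
      exact ⟨hba, hcb, hca, hG.exists_comp_eq hba⟩
  · obtain ⟨h₁, h₂, -⟩ := hG x y hxy
    exact ⟨h₁, h₂, hG.exists_comp_eq h₁⟩

end ChainPaper
end

section
/- Let G be a hom-set strong small category. Then G is finite (i.e., its set of morphisms G_1 is finite) if and only if its set of objects G_0 is finite and for every object a the endomorphism monoid G(a) is finite. -/
open CategoryTheory

namespace ChainPaper

/-- In a hom-set strong category, finiteness of the endomorphisms of the source forces
finiteness of a hom-set. -/
theorem HomSetStrong.finite_hom {G : Type*} [Category G] (hG : HomSetStrong G) (a b : G)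
    [Finite (a ⟶ a)] : Finite (a ⟶ b) := by
  cases isEmpty_or_nonempty (a ⟶ b) with
  | inl _ => infer_instance
  | inr hab =>
    obtain ⟨-, -, g, h, hg⟩ := hG b a (Or.inl hab)
    have : IsSplitMono h := IsSplitMono.mk' ⟨g, hg⟩
    exact Finite.of_injective (fun f : a ⟶ b => f ≫ h) fun _ _ e => (cancel_mono h).1 e

theorem statement_10 (G : Type*) [Category G] (hG : HomSetStrong G) :
    Finite (Σ a : G, Σ b : G, a ⟶ b) ↔ (Finite G ∧ ∀ a : G, Finite (a ⟶ a)) := by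
  constructor
  · intro _
    refine ⟨Finite.of_injective
      (fun a : G => (⟨a, a, 𝟙 a⟩ : Σ a : G, Σ b : G, a ⟶ b)) fun _ _ e => congrArg Sigma.fst e,
      fun a => Finite.of_injective
        (fun f : a ⟶ a => (⟨a, a, f⟩ : Σ a : G, Σ b : G, a ⟶ b)) fun _ _ e => ?_⟩
    simpa using e
  · rintro ⟨_, _⟩
    have := hG.finite_hom
    infer_instance

end ChainPaper
end
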